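/- If E is a non-trivial regular, locally finite equational theory over the signature Σ, then E is Noetherian w.r.t. the unrestricted instantiation preorder, i.e., there is no infinite strictly descending chain of substitutions σ₁ >_E^V σ₂ >_E^V σ₃ >_E^V ⋯. -/

import Mathlib

namespace UnifFW

/-- First-order terms over a signature `F` (an arity-indexed family of function
symbols), with variables from the countably infinite set `V = ℕ`. -/
inductive Term (F : ℕ → Type) : Type
  | var : ℕ → Term F
  | app : (n : ℕ) → F n → (Fin n → Term F) → Term F

variable {F : ℕ → Type}

/-- The set of variables occurring in a term. -/
def Term.vars : Term F → Set ℕ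
  | .var x => {x}
  | .app _ _ ts => ⋃ i, (ts i).vars

/-- Homomorphic extension of a map `V → T(Σ,V)` to terms. -/
def Term.subst (σ : ℕ → Term F) : Term F → Term F
  | .var x => σ x
  | .app n f ts => .app n f (fun i => (ts i).subst σ)

/-- The congruence `≈_E` induced by a set `E` of identities: the smallest
equivalence relation containing all substitution instances of identities of `E`
and compatible with the term constructors. -/
inductive EqE (E : Set (Term F × Term F)) : Term F → Term F → Prop
  | ax {s t : Term F} (σ : ℕ → Term F) : (s, t) ∈ E → EqE E (s.subst σ) (t.subst σ)
  | refl (t : Term F) : EqE E t t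
  | symm {s t : Term F} : EqE E s t → EqE E t s
  | trans {s t u : Term F} : EqE E s t → EqE E t u → EqE E s u
  | congr {n : ℕ} (f : F n) {ts us : Fin n → Term F} :
      (∀ i, EqE E (ts i) (us i)) → EqE E (.app n f ts) (.app n f us)

/-- A theory is non-trivial if distinct variables are not equated. -/
def NonTrivial (E : Set (Term F × Term F)) : Prop :=
  ∀ x y : ℕ, x ≠ y → ¬ EqE E (.var x) (.var y)

/-- A theory is regular if both sides of each identity have the same variables. -/
def Regular (E : Set (Term F × Term F)) : Prop :=
  ∀ p ∈ E, (Prod.fst p).vars = (Prod.snd p).vars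

/-- A substitution: a map `V → T(Σ,V)` with finite domain. -/
structure Subst (F : ℕ → Type) where
  toFun : ℕ → Term F
  finite_dom : {x : ℕ | toFun x ≠ Term.var x}.Finite

/-- The domain of a substitution. -/
def Subst.Dom (σ : Subst F) : Set ℕ := {x : ℕ | σ.toFun x ≠ Term.var x}

/-- The variable range of a substitution: all variables occurring in the images
of domain variables. -/
def Subst.VRan (σ : Subst F) : Set ℕ := ⋃ x ∈ σ.Dom, (σ.toFun x).vars

/-- The instantiation preorder `σ ≤_E^X θ`: some substitution `λ` satisfies
`λ(σ(x)) ≈_E θ(x)` for all `x ∈ X`. -/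
def InstLE (E : Set (Term F × Term F)) (X : Set ℕ) (σ θ : Subst F) : Prop :=
  ∃ lam : Subst F, ∀ x ∈ X, EqE E ((σ.toFun x).subst lam.toFun) (θ.toFun x)

/-- The equivalence `σ ∼_E^X θ` induced by the instantiation preorder. -/
def InstEquiv (E : Set (Term F × Term F)) (X : Set ℕ) (σ θ : Subst F) : Prop :=
  InstLE E X σ θ ∧ InstLE E X θ σ

/-- The strict instantiation order `σ <_E^X θ`. -/
def InstLT (E : Set (Term F × Term F)) (X : Set ℕ) (σ θ : Subst F) : Prop :=
  InstLE E X σ θ ∧ ¬ InstLE E X θ σ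

/-- The set of variables occurring in a unification problem. -/
def VarsP (Γ : Set (Term F × Term F)) : Set ℕ :=
  ⋃ p ∈ Γ, (Prod.fst p).vars ∪ (Prod.snd p).vars

/-- `σ` is an `E`-unifier of the unification problem `Γ`. -/
def Unifier (E Γ : Set (Term F × Term F)) (σ : Subst F) : Prop :=
  ∀ p ∈ Γ, EqE E ((Prod.fst p).subst σ.toFun) ((Prod.snd p).subst σ.toFun)

/-- A unification problem is solvable if it has a unifier. -/
def Solvable (E Γ : Set (Term F × Term F)) : Prop := ∃ σ : Subst F, Unifier E Γ σ

/-- `S` is a complete set of `E`-unifiers of `Γ` w.r.t. `≤_E^X`. -/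
def CompleteSet (E Γ : Set (Term F × Term F)) (X : Set ℕ) (S : Set (Subst F)) : Prop :=
  (∀ σ ∈ S, Unifier E Γ σ) ∧ ∀ θ : Subst F, Unifier E Γ θ → ∃ σ ∈ S, InstLE E X σ θ

/-- `S` is a minimal complete set of `E`-unifiers of `Γ` w.r.t. `≤_E^X`:
complete, and no two distinct elements are comparable. -/
def MinimalComplete (E Γ : Set (Term F × Term F)) (X : Set ℕ) (S : Set (Subst F)) : Prop :=
  CompleteSet E Γ X S ∧ ∀ σ ∈ S, ∀ θ ∈ S, σ ≠ θ → ¬ InstLE E X σ θ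

/-- `Γ` has unification type unitary w.r.t. `≤_E^X`. -/
def TypeUnitary (E Γ : Set (Term F × Term F)) (X : Set ℕ) : Prop :=
  ∃ σ : Subst F, MinimalComplete E Γ X {σ}

/-- `Γ` has unification type finitary w.r.t. `≤_E^X`. -/
def TypeFinitary (E Γ : Set (Term F × Term F)) (X : Set ℕ) : Prop :=
  ∃ S : Set (Subst F), MinimalComplete E Γ X S ∧ S.Finite ∧ 1 < S.ncard

/-- `Γ` has unification type infinitary w.r.t. `≤_E^X`. -/
def TypeInfinitary (E Γ : Set (Term F × Term F)) (X : Set ℕ) : Prop :=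
  ∃ S : Set (Subst F), MinimalComplete E Γ X S ∧ S.Infinite

/-- `Γ` has unification type zero w.r.t. `≤_E^X`. -/
def TypeZero (E Γ : Set (Term F × Term F)) (X : Set ℕ) : Prop :=
  ¬ ∃ S : Set (Subst F), MinimalComplete E Γ X S

/-- `σ` is a `≤_E^X`-minimal `E`-unifier of `Γ`. -/
def MinUnifier (E Γ : Set (Term F × Term F)) (X : Set ℕ) (σ : Subst F) : Prop :=
  Unifier E Γ σ ∧ ∀ θ : Subst F, Unifier E Γ θ → InstLE E X θ σ → InstLE E X σ θ

/-- The set `C_E(Γ)` of unifiers all of whose range variables occur in the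
images of at least two distinct variables. -/
def CSet (E Γ : Set (Term F × Term F)) : Set (Subst F) :=
  {σ : Subst F | Unifier E Γ σ ∧
    ∀ y ∈ σ.VRan, ∃ x x' : ℕ, x ≠ x' ∧ y ∈ (σ.toFun x).vars ∩ (σ.toFun x').vars}

/-- `E` is Noetherian w.r.t. the unrestricted instantiation preorder: there is
no infinite strictly descending chain `σ₁ >_E^V σ₂ >_E^V ⋯`. -/
def Noetherian (E : Set (Term F × Term F)) : Prop :=
  ¬ ∃ f : ℕ → Subst F, ∀ n : ℕ, InstLT E Set.univ (f (n + 1)) (f n)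


/-- `E` is locally finite: for every finite set `X` of variables, the set of
`≈_E`-equivalence classes of terms with variables from `X` is finite. -/
def LocallyFinite {F : ℕ → Type} (E : Set (Term F × Term F)) : Prop :=
  ∀ X : Set ℕ, X.Finite →
    {C : Set (Term F) | ∃ t : Term F, t.vars ⊆ X ∧ C = {s : Term F | EqE E s t}}.Finite

theorem Term.vars_finite (t : Term F) : t.vars.Finite := by
  induction t with
  | var x => exact Set.finite_singleton x
  | app n f ts ih => exact Set.finite_iUnion ih

theorem Term.mem_vars_subst {σ : ℕ → Term F} {t : Term F} {v : ℕ} :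
    v ∈ (t.subst σ).vars ↔ ∃ y ∈ t.vars, v ∈ (σ y).vars := by
  induction t with
  | var x => simp [Term.subst, Term.vars]
  | app n f ts ih =>
    simp only [Term.subst, Term.vars, Set.mem_iUnion, ih]
    constructor
    · rintro ⟨i, y, hy, hv⟩
      exact ⟨y, ⟨i, hy⟩, hv⟩
    · rintro ⟨y, ⟨i, hy⟩, hv⟩
      exact ⟨i, y, hy, hv⟩

theorem Term.subst_subst (σ τ : ℕ → Term F) (t : Term F) :
    (t.subst σ).subst τ = t.subst fun x => (σ x).subst τ := by
  induction t with
  | var x => rfl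
  | app n f ts ih => simp only [Term.subst, ih]

theorem Term.subst_var (t : Term F) : t.subst Term.var = t := by
  induction t with
  | var x => rfl
  | app n f ts ih => simp only [Term.subst, ih]

variable {E : Set (Term F × Term F)}

theorem EqE.subst_congr {σ τ : ℕ → Term F} {t : Term F}
    (h : ∀ y ∈ t.vars, EqE E (σ y) (τ y)) : EqE E (t.subst σ) (t.subst τ) := by
  induction t with
  | var x => exact h x rfl
  | app n f ts ih =>
    exact EqE.congr f fun i => ih i fun y hy => h y (Set.mem_iUnion.2 ⟨i, hy⟩)

theorem EqE.subst {s t : Term F} (h : EqE E s t) (τ : ℕ → Term F) :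
    EqE E (s.subst τ) (t.subst τ) := by
  induction h with
  | ax σ hst =>
    rw [Term.subst_subst, Term.subst_subst]
    exact EqE.ax _ hst
  | refl t => exact EqE.refl _
  | symm _ ih => exact ih.symm
  | trans _ _ ih₁ ih₂ => exact ih₁.trans ih₂
  | congr f _ ih => exact EqE.congr f ih

theorem EqE.vars_eq (hreg : Regular E) {s t : Term F} (h : EqE E s t) : s.vars = t.vars := by
  induction h with
  | ax σ hst =>
    ext v
    have hvars := hreg _ hst
    simp only at hvars
    rw [Term.mem_vars_subst, Term.mem_vars_subst, hvars]
  | refl t => rfl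
  | symm _ ih => exact ih.symm
  | trans _ _ ih₁ ih₂ => exact ih₁.trans ih₂
  | congr f _ ih => simp only [Term.vars, ih]

/-- The composition of two substitutions, applying `σ` first. -/
def Subst.comp (σ τ : Subst F) : Subst F where
  toFun x := (σ.toFun x).subst τ.toFun
  finite_dom := by
    refine (σ.finite_dom.union τ.finite_dom).subset fun x hx => ?_
    by_contra hcon
    simp only [Set.mem_union, Set.mem_ofPred_eq, not_or, not_not] at hcon
    refine hx ?_
    rw [hcon.1]
    exact hcon.2

theorem InstLE.refl (X : Set ℕ) (σ : Subst F) : InstLE E X σ σ :=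
  ⟨⟨Term.var, by simp⟩, fun x _ => by rw [Term.subst_var]; exact EqE.refl _⟩

theorem InstLE.trans {X : Set ℕ} {σ τ θ : Subst F} (h₁ : InstLE E X σ τ)
    (h₂ : InstLE E X τ θ) : InstLE E X σ θ := by
  obtain ⟨lam, hlam⟩ := h₁
  obtain ⟨mu, hmu⟩ := h₂
  refine ⟨lam.comp mu, fun x hx => ?_⟩
  have h := ((hlam x hx).subst mu.toFun).trans (hmu x hx)
  rwa [Term.subst_subst] at h

/-- An injection from a subset of a finite set `X` into `X` extends to a permutation
fixing all points outside `X`. -/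
theorem exists_perm_extend (X : Finset ℕ) (D : Set ℕ) (j : ℕ → ℕ)
    (hinj : Set.InjOn j (X \ D)) (hmaps : Set.MapsTo j (X \ D) X) :
    ∃ π : Equiv.Perm ℕ, (∀ x ∈ X, x ∉ D → π x = j x) ∧ ∀ x ∉ X, π x = x := by
  classical
  obtain ⟨g, hg⟩ := Set.MapsTo.exists_equiv_extend_of_card_eq (α := X) (t := X)
    (s := {x | (x : ℕ) ∉ D}) (f := fun x => j x) (by simp)
    (fun x hx => hmaps ⟨x.2, hx⟩)
    (fun x hx y hy hxy => Subtype.ext (hinj ⟨x.2, hx⟩ ⟨y.2, hy⟩ hxy))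
  refine ⟨Equiv.Perm.ofSubtype g, fun x hx hxD => ?_, fun x hx => ?_⟩
  · rw [Equiv.Perm.ofSubtype_apply_of_mem g hx]
    exact hg ⟨x, hx⟩ hxD
  · exact Equiv.Perm.ofSubtype_apply_of_not_mem g hx

/-- If every variable outside a finite set `D` is the sole variable of some image under `μ`,
then, up to a finite permutation `π`, it is the sole variable of its own image. -/
theorem Subst.exists_perm_vars_eq (μ : Subst F) {D : Set ℕ} (hD : D.Finite)
    (h : ∀ x ∉ D, ∃ y, (μ.toFun y).vars = {x}) :
    ∃ π : Equiv.Perm ℕ, {x | π x ≠ x}.Finite ∧ ∀ x ∉ D, (μ.toFun (π x)).vars = {x} := by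
  classical
  have hfin := hD.union μ.finite_dom
  set X := hfin.toFinset with hXdef
  have hX : ∀ x ∉ X, x ∉ D ∧ μ.toFun x = Term.var x := fun x hx => by
    simpa [hXdef] using hx
  choose! j hj using h
  obtain ⟨π, hπ, hπ'⟩ := exists_perm_extend X D j
    (fun x hx y hy hxy => by
      have hx' := hj x hx.2
      rw [hxy, hj y hy.2] at hx'
      exact (Set.singleton_injective hx').symm)
    (fun x hx => by
      by_contra hcon
      have hx' := hj x hx.2
      rw [(hX (j x) hcon).2] at hx'
      have hjx : j x = x := Set.singleton_injective hx'
      rw [hjx] at hcon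
      exact hcon hx.1)
  refine ⟨π, X.finite_toSet.subset fun x hx => ?_, fun x hx => ?_⟩
  · by_contra hcon
    exact hx (hπ' x hcon)
  · by_cases hxX : x ∈ X
    · rw [hπ x hxX hx, hj x hx]
    · rw [hπ' x hxX, (hX x hxX).2]
      rfl

/-- Renaming the range of a substitution by a finite permutation. -/
def Subst.rename (σ : Subst F) (π : Equiv.Perm ℕ) (hπ : {x | π x ≠ x}.Finite) : Subst F :=
  σ.comp ⟨fun x => .var (π x), hπ.subset fun _ hx h => hx (congrArg _ h)⟩

/-- Every generalization of `θ` is, up to equivalence, one whose value at `x` only uses `x` and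
variables from a finite set depending only on `θ`. -/
theorem exists_equiv_vars_subset (hreg : Regular E) {σ θ : Subst F}
    (h : InstLE E Set.univ σ θ) :
    ∃ σ' : Subst F, InstEquiv E Set.univ σ σ' ∧
      ∀ x, (σ'.toFun x).vars ⊆ insert x (θ.Dom ∪ θ.VRan) := by
  obtain ⟨μ, hμ⟩ := h
  have hvars : ∀ x y v, y ∈ (σ.toFun x).vars → v ∈ (μ.toFun y).vars →
      v ∈ (θ.toFun x).vars := fun x y v hy hv => by
    rw [← (hμ x trivial).vars_eq hreg]
    exact Term.mem_vars_subst.2 ⟨y, hy, hv⟩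
  have hθ : ∀ x ∉ θ.Dom, θ.toFun x = Term.var x := fun x hx => not_not.1 hx
  obtain ⟨π, hπfin, hπ⟩ := μ.exists_perm_vars_eq θ.finite_dom (fun x hx => by
    have hx' : x ∈ ((σ.toFun x).subst μ.toFun).vars := by
      rw [(hμ x trivial).vars_eq hreg, hθ x hx]
      rfl
    obtain ⟨y, hy, hxy⟩ := Term.mem_vars_subst.1 hx'
    refine ⟨y, Set.Subset.antisymm (fun v hv => ?_) (Set.singleton_subset_iff.2 hxy)⟩
    have := hvars x y v hy hv
    rwa [hθ x hx] at this)
  have hπfin' : {x | π.symm x ≠ x}.Finite :=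
    hπfin.subset fun x hx hx' => hx (by rw [Equiv.symm_apply_eq, hx'])
  refine ⟨σ.rename π.symm hπfin', ⟨⟨_, fun x _ => EqE.refl _⟩,
    ⟨⟨fun x => .var (π x), hπfin.subset fun x hx h => hx (congrArg _ h)⟩, fun x _ => ?_⟩⟩,
    fun x v hv => ?_⟩
  · simp only [Subst.rename, Subst.comp, Term.subst_subst, Term.subst,
      Equiv.apply_symm_apply]
    rw [Term.subst_var]
    exact EqE.refl _
  · obtain ⟨y, hy, hvy⟩ := Term.mem_vars_subst.1 hv
    have hvy' : v = π.symm y := hvy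
    by_cases hvD : v ∈ θ.Dom
    · exact Or.inr (Or.inl hvD)
    have hv' : v ∈ (μ.toFun y).vars := by
      have := hπ v hvD
      rw [hvy', Equiv.apply_symm_apply, ← hvy'] at this
      rw [this]
      rfl
    have hvx := hvars x y v hy hv'
    by_cases hxD : x ∈ θ.Dom
    · exact Or.inr (Or.inr (Set.mem_biUnion hxD hvx))
    · rw [hθ x hxD] at hvx
      exact Or.inl hvx

/-- A sequence of functions with values in a finite set is, on any finite set, constant along an
ultrafilter. -/
theorem exists_eventually_eqOn_of_finite {α β ι : Type*} (U : Ultrafilter ι) {T : Set α}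
    (hT : T.Finite) {A : Set β} (hA : A.Finite) (c : ι → α → β)
    (hc : ∀ i, ∀ y ∈ T, c i y ∈ A) :
    ∃ a : α → β, (∀ y ∈ T, a y ∈ A) ∧ ∀ᶠ i in U, ∀ y ∈ T, c i y = a y := by
  have h : ∀ y ∈ T, ∃ b ∈ A, ∀ᶠ i in U, c i y = b := fun y hy => by
    have hmem : (⋃ b ∈ A, {i | c i y = b}) ∈ U :=
      Filter.mem_of_superset Filter.univ_mem fun i _ => Set.mem_biUnion (hc i y hy) rfl
    exact (Ultrafilter.finite_biUnion_mem_iff hA).1 hmem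
  have : ∀ y, ∃ b, y ∈ T → b ∈ A ∧ ∀ᶠ i in U, c i y = b := fun y => by
    by_cases hy : y ∈ T
    · obtain ⟨b, hb⟩ := h y hy
      exact ⟨b, fun _ => hb⟩
    · by_cases hι : Nonempty ι
      · exact ⟨c hι.some y, fun hy' => absurd hy' hy⟩
      · exact absurd (Filter.nonempty_of_neBot U.toFilter) hι
  choose a ha using this
  exact ⟨a, fun y hy => (ha y hy).1,
    (Filter.eventually_all_finite hT).2 fun y hy => (ha y hy).2⟩

/-- A descending sequence of substitutions whose values at `x` only use `x` and variables from a
fixed finite set is not strictly descending. -/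
theorem exists_lt_instLE (hreg : Regular E) (hlf : LocallyFinite E) {T : Set ℕ} (hT : T.Finite)
    (g : ℕ → Subst F) (hg : ∀ n m, n < m → InstLE E Set.univ (g m) (g n))
    (hgT : ∀ n x, ((g n).toFun x).vars ⊆ insert x T) :
    ∃ n m, n < m ∧ InstLE E Set.univ (g n) (g m) := by
  classical
  have hlam : ∀ m n, ∃ lam : Subst F, n < m →
      ∀ x, EqE E (((g m).toFun x).subst lam.toFun) ((g n).toFun x) := fun m n => by
    by_cases hnm : n < m
    · obtain ⟨lam, h⟩ := hg n m hnm
      exact ⟨lam, fun _ x => h x trivial⟩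
    · exact ⟨g 0, fun h => absurd h hnm⟩
  choose lam hlam using hlam
  let U := Filter.hyperfilter ℕ
  have hlt : ∀ n : ℕ, ∀ᶠ m in (U : Filter ℕ), n < m := fun n =>
    Nat.hyperfilter_le_atTop (Filter.eventually_gt_atTop n)
  let c : ℕ → ℕ → ℕ → Set (Term F) := fun n m y =>
    {s | EqE E s ((lam m n).toFun y) ∧ ((lam m n).toFun y).vars ⊆ T}
  have hA := (hlf T hT).insert ∅
  have hc : ∀ n m, ∀ y ∈ T, c n m y ∈ insert ∅ {C : Set (Term F) |
      ∃ t : Term F, t.vars ⊆ T ∧ C = {s : Term F | EqE E s t}} := fun n m y _ => by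
    by_cases h : ((lam m n).toFun y).vars ⊆ T
    · exact Or.inr ⟨_, h, by simp [c, h]⟩
    · exact Or.inl (by simp [c, h])
  choose L hLA hL using fun n => exists_eventually_eqOn_of_finite U hT hA (c n) (hc n)
  obtain ⟨e, -, he⟩ := exists_eventually_eqOn_of_finite U hT hA L hLA
  obtain ⟨k, hk⟩ := he.exists
  let S := (g k).Dom ∪ T
  have hS : S.Finite := (g k).finite_dom.union hT
  obtain ⟨G, -, hG⟩ := exists_eventually_eqOn_of_finite U hS (hlf S hS)
    (fun n x => {s | EqE E s ((g n).toFun x)}) (fun n x hx =>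
      ⟨_, (hgT n x).trans (Set.insert_subset hx Set.subset_union_right), rfl⟩)
  obtain ⟨n, ⟨⟨hkn, hckn⟩, hLn⟩, hGn⟩ := (((hlt k).and (hL k)).and he).and hG |>.exists
  obtain ⟨m, ⟨hnm, hcnm⟩, hGm⟩ := ((hlt n).and (hL n)).and hG |>.exists
  have hcol : ∀ x ∈ S, EqE E ((g n).toFun x) ((g m).toFun x) := fun x hx => by
    have h : (g n).toFun x ∈ {s | EqE E s ((g n).toFun x)} := EqE.refl _
    rw [hGn x hx, ← hGm x hx] at h
    exact h
  have hagree : ∀ v ∈ T, ((lam n k).toFun v).vars ⊆ T →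
      EqE E ((lam m n).toFun v) ((lam n k).toFun v) := fun v hv hvT => by
    have h : (lam n k).toFun v ∈ c k n v := ⟨EqE.refl _, hvT⟩
    rw [hckn v hv, hk v hv, ← hLn v hv, ← hcnm v hv] at h
    exact h.1.symm
  let κ : Subst F := ⟨fun x => if x ∈ S then .var x else (g m).toFun x,
    (g m).finite_dom.subset fun x hx h => hx (by simp [h])⟩
  let W : Set ℕ := ⋃ x ∈ S, ((g n).toFun x).vars
  have hW : W.Finite := hS.biUnion fun x _ => Term.vars_finite _
  let ρ : Subst F :=
    ⟨fun v => if v ∈ W then (lam m n).toFun v else ((lam n k).comp κ).toFun v,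
      (hW.union ((lam n k).comp κ).finite_dom).subset fun v hv => by
        by_cases hvW : v ∈ W
        · exact Or.inl hvW
        · exact Or.inr (by simpa [hvW] using hv)⟩
  refine ⟨n, m, hnm, ρ, fun x _ => ?_⟩
  by_cases hx : x ∈ S
  · have h₁ : EqE E (((g n).toFun x).subst ρ.toFun)
        (((g n).toFun x).subst (lam m n).toFun) :=
      EqE.subst_congr fun v hv => by
        have hvW : v ∈ W := Set.mem_biUnion hx hv
        simp only [ρ, hvW, if_true]
        exact EqE.refl _
    exact ((h₁.trans ((hcol x hx).subst _)).trans (hlam m n hnm x)).trans (hcol x hx)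
  · have hgk : (g k).toFun x = .var x := by
      by_contra h
      exact hx (Or.inl h)
    have h₁ : EqE E (((g n).toFun x).subst ρ.toFun)
        (((g n).toFun x).subst ((lam n k).comp κ).toFun) :=
      EqE.subst_congr fun v hv => by
        by_cases hvW : v ∈ W
        · simp only [ρ, hvW, if_true]
          obtain ⟨x', hx', hv'⟩ := Set.mem_iUnion₂.1 hvW
          have hvT : v ∈ T := by
            rcases hgT n x hv with h | h
            · rcases hgT n x' hv' with h' | h'
              · exact absurd (h.symm.trans h' ▸ hx') hx
              · exact h'
            · exact h
          have hsub : ((lam n k).toFun v).vars ⊆ T := fun w hw => by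
            have hw₁ : w ∈ ((g k).toFun x).vars := by
              rw [← (hlam n k hkn x).vars_eq hreg]
              exact Term.mem_vars_subst.2 ⟨v, hv, hw⟩
            have hw₂ : w ∈ ((g k).toFun x').vars := by
              rw [← (hlam n k hkn x').vars_eq hreg]
              exact Term.mem_vars_subst.2 ⟨v, hv', hw⟩
            rw [hgk] at hw₁
            rcases hgT k x' hw₂ with h | h
            · exact absurd (hw₁.symm.trans h ▸ hx') hx
            · exact h
          have h₂ : EqE E (((lam n k).toFun v).subst Term.var)
              (((lam n k).toFun v).subst κ.toFun) :=
            EqE.subst_congr fun w hw => by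
              have hwS : w ∈ S := Or.inr (hsub hw)
              simp only [κ, hwS, if_true]
              exact EqE.refl _
          rw [Term.subst_var] at h₂
          exact (hagree v hvT hsub).trans h₂
        · simp only [ρ, hvW, if_false]
          exact EqE.refl _
    have h₂ := (hlam n k hkn x).subst κ.toFun
    rw [Term.subst_subst, hgk] at h₂
    have h₃ := h₁.trans h₂
    simpa only [Term.subst, κ, hx, if_false] using h₃

/-- Proposition `locally:finite:is:noeth:prop`: every
non-trivial regular, locally finite equational theory is Noetherian w.r.t. the
unrestricted instantiation preorder. -/
theorem stmt14 {F : ℕ → Type} (E : Set (Term F × Term F)) (hE : NonTrivial E)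
    (hreg : Regular E) (hlf : LocallyFinite E) : Noetherian E := by
  rintro ⟨f, hf⟩
  have hdesc : ∀ n m, n ≤ m → InstLE E Set.univ (f m) (f n) := fun n m hnm => by
    induction m, hnm using Nat.le_induction with
    | base => exact InstLE.refl _ _
    | succ m _ ih => exact (hf m).1.trans ih
  choose g hgf hgT using fun n => exists_equiv_vars_subset hreg (hdesc 0 n n.zero_le)
  have hT : ((f 0).Dom ∪ (f 0).VRan).Finite :=
    (f 0).finite_dom.union ((f 0).finite_dom.biUnion fun x _ => Term.vars_finite _)
  obtain ⟨n, m, hnm, h⟩ := exists_lt_instLE hreg hlf hT g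
    (fun n m hnm => ((hgf m).2.trans (hdesc n m hnm.le)).trans (hgf n).1) hgT
  exact (hf n).2 ((((hgf n).1.trans h).trans (hgf m).2).trans (hdesc (n + 1) m hnm))
end UnifFW
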